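/- arXiv:1210.7773 — 3 statements merged into one kernel-verified Lean document; each statement's English description precedes it below -/
import Mathlib

section
/- For each index i ∈ {1, …, k} and each fixed (x₁, …, x̂_i, …, x_k) ∈ ℝ^{k-1} (the hat denoting omission of the i-th coordinate), the integral of ψ(x₁, …, x_k) over x_i ∈ ℝ equals (2π)^{-(k-1)/2} e^{-(x₁² + ⋯ + x̂_i² + ⋯ + x_k²)/2}, i.e. integrating out any single coordinate of ψ yields the (k-1)-dimensional standard Gaussian density. -/
open Real MeasureTheory

/-- The density `ψ` of the measure `ν` on `ℝ^k`. -/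
noncomputable def psi (k : ℕ) (x : Fin k → ℝ) : ℝ :=
  (2 * Real.pi) ^ (-(k : ℝ) / 2) *
    (1 + (∏ i, x i) * Real.exp (-(∑ i, x i ^ 2) / 2)) *
    Real.exp (-(∑ i, x i ^ 2) / 2)

theorem integral_mul_exp_neg_sq : ∫ t : ℝ, t * Real.exp (-(t ^ 2)) = 0 := by
  have h := integral_neg_eq_self (fun t : ℝ => t * Real.exp (-(t ^ 2))) volume
  simp only [neg_sq, neg_mul, integral_neg] at h
  linarith

theorem psi_update (k : ℕ) (i : Fin k) (x : Fin k → ℝ) (t : ℝ) :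
    psi k (Function.update x i t) =
      (2 * Real.pi) ^ (-(k : ℝ) / 2) *
          Real.exp (-(∑ j ∈ Finset.univ.erase i, x j ^ 2) / 2) *
          Real.exp (-(1 / 2) * t ^ 2) +
        (2 * Real.pi) ^ (-(k : ℝ) / 2) * (∏ j ∈ Finset.univ.erase i, x j) *
          Real.exp (-(∑ j ∈ Finset.univ.erase i, x j ^ 2)) *
          (t * Real.exp (-(t ^ 2))) := by
  have hsum : ∑ j, Function.update x i t j ^ 2 =
      t ^ 2 + ∑ j ∈ Finset.univ.erase i, x j ^ 2 := by
    rw [← Finset.add_sum_erase _ _ (Finset.mem_univ i), Function.update_self]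
    congr 1
    refine Finset.sum_congr rfl fun j hj => ?_
    rw [Function.update_of_ne (Finset.ne_of_mem_erase hj)]
  have hprod : ∏ j, Function.update x i t j = t * ∏ j ∈ Finset.univ.erase i, x j := by
    rw [Finset.prod_update_of_mem (Finset.mem_univ i), Finset.sdiff_singleton_eq_erase]
  rw [psi, hsum, hprod]
  set S := ∑ j ∈ Finset.univ.erase i, x j ^ 2
  have hhalf : Real.exp (-(t ^ 2 + S) / 2) =
      Real.exp (-S / 2) * Real.exp (-(1 / 2) * t ^ 2) := by
    rw [← Real.exp_add]; ring_nf
  have hfull : Real.exp (-(t ^ 2 + S) / 2) * Real.exp (-(t ^ 2 + S) / 2) =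
      Real.exp (-S) * Real.exp (-(t ^ 2)) := by
    rw [← Real.exp_add, ← Real.exp_add]; ring_nf
  linear_combination (2 * Real.pi) ^ (-(k : ℝ) / 2) * hhalf +
    (2 * Real.pi) ^ (-(k : ℝ) / 2) * t * (∏ j ∈ Finset.univ.erase i, x j) * hfull

/-- Integrating out any single coordinate of `ψ` yields the `(k-1)`-dimensional
standard Gaussian density in the remaining coordinates. -/
theorem integral_psi_update (k : ℕ) (hk : 1 < k) (i : Fin k) (x : Fin k → ℝ) :
    ∫ t : ℝ, psi k (Function.update x i t) =
      (2 * Real.pi) ^ (-((k : ℝ) - 1) / 2) *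
        Real.exp (-(∑ j ∈ Finset.univ.erase i, x j ^ 2) / 2) := by
  have hodd : Integrable fun t : ℝ => t * Real.exp (-(t ^ 2)) := by
    simpa using integrable_mul_exp_neg_mul_sq one_pos
  have hpow : (2 * Real.pi) ^ (-(k : ℝ) / 2) * √(Real.pi / (1 / 2)) =
      (2 * Real.pi) ^ (-((k : ℝ) - 1) / 2) := by
    rw [show Real.pi / (1 / 2) = 2 * Real.pi by ring, Real.sqrt_eq_rpow,
      ← Real.rpow_add (by positivity)]
    ring_nf
  simp_rw [psi_update]
  rw [integral_add ((integrable_exp_neg_mul_sq one_half_pos).const_mul _) (hodd.const_mul _),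
    integral_const_mul, integral_const_mul, integral_gaussian, integral_mul_exp_neg_sq, ← hpow]
  ring
end

section
/- For each index i ∈ {1, …, k}, the pushforward of ν under the coordinate-deletion map ℝ^k → ℝ^{k-1}, x ↦ (x₁, …, x̂_i, …, x_k) (omitting the i-th coordinate), equals the (k-1)-fold product of the standard Gaussian measure N(0,1) on ℝ. In particular, if (X₁, …, X_k) has distribution ν, then for each i the random variables X₁, …, X̂_i, …, X_k are i.i.d. N(0,1). -/
open Real MeasureTheory ProbabilityTheory

/-- The measure `ν` on `ℝ^k` with density `ψ` with respect to Lebesgue measure. -/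
noncomputable def nu (k : ℕ) : Measure (Fin k → ℝ) :=
  (volume : Measure (Fin k → ℝ)).withDensity fun x => ENNReal.ofReal (psi k x)

/-- The map `ℝ^k → ℝ^(k-1)` deleting the `i`-th coordinate. -/
def deleteCoord (k : ℕ) (i : Fin k) (x : Fin k → ℝ) (j : Fin (k - 1)) : ℝ :=
  if h : (j : ℕ) < (i : ℕ) then x ⟨j, lt_trans h i.isLt⟩
  else x ⟨(j : ℕ) + 1, by have := j.isLt; omega⟩

open scoped ENNReal

/-- Tonelli's theorem for a product of functions of the separate coordinates. -/
theorem lintegral_fin_prod_eq_prod {n : ℕ} {α : Fin n → Type*} [∀ i, MeasurableSpace (α i)]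
    (μ : ∀ i, Measure (α i)) [∀ i, SigmaFinite (μ i)] {f : ∀ i, α i → ℝ≥0∞}
    (hf : ∀ i, Measurable (f i)) :
    ∫⁻ x, ∏ i, f i (x i) ∂Measure.pi μ = ∏ i, ∫⁻ t, f i t ∂μ i := by
  induction n with
  | zero => simp
  | succ n ih =>
    have hf' : Measurable fun y : ∀ j, α (Fin.succAbove 0 j) =>
        ∏ j, f (Fin.succAbove 0 j) (y j) :=
      Finset.measurable_prod _ fun j _ => (hf _).comp (measurable_pi_apply j)
    have hmul : Measurable fun p : α 0 × ∀ j, α (Fin.succAbove 0 j) =>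
        f 0 p.1 * ∏ j, f (Fin.succAbove 0 j) (p.2 j) :=
      ((hf 0).comp measurable_fst).mul (hf'.comp measurable_snd)
    calc
      _ = ∫⁻ x, (fun p : α 0 × ∀ j, α (Fin.succAbove 0 j) =>
            f 0 p.1 * ∏ j, f (Fin.succAbove 0 j) (p.2 j))
            (MeasurableEquiv.piFinSuccAbove α 0 x) ∂Measure.pi μ := by
          refine lintegral_congr fun x => ?_
          rw [Fin.prod_univ_succAbove _ 0]
          rfl
      _ = _ := by
          rw [(measurePreserving_piFinSuccAbove μ 0).lintegral_comp hmul,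
            lintegral_prod_mul (hf 0).aemeasurable hf'.aemeasurable,
            ih (fun j => μ (Fin.succAbove 0 j)) fun j => hf _, Fin.prod_univ_succAbove _ 0]

/-- A product of measures with densities has the product density. -/
theorem pi_withDensity {n : ℕ} {α : Fin n → Type*} [∀ i, MeasurableSpace (α i)]
    (μ : ∀ i, Measure (α i)) [∀ i, SigmaFinite (μ i)] {f : ∀ i, α i → ℝ≥0∞}
    [∀ i, SigmaFinite ((μ i).withDensity (f i))] (hf : ∀ i, Measurable (f i)) :
    Measure.pi (fun i => (μ i).withDensity (f i)) =
      (Measure.pi μ).withDensity fun x => ∏ i, f i (x i) := by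
  refine Measure.pi_eq fun s hs => ?_
  rw [withDensity_apply _ (MeasurableSet.univ_pi hs), Measure.restrict_pi_pi,
    lintegral_fin_prod_eq_prod _ hf]
  simp_rw [withDensity_apply _ (hs _)]

/-- An odd perturbation of the density of a power of a symmetric probability measure does not
change the marginals obtained by deleting one coordinate. -/
theorem map_removeNth_withDensity_one_add_prod {n : ℕ} (i : Fin (n + 1)) (μ : Measure ℝ)
    [IsProbabilityMeasure μ] (hμ : μ.map (fun t => -t) = μ) {g : ℝ → ℝ} (hg : Measurable g)
    (hodd : ∀ t, g (-t) = -g t) (hbound : ∀ t, |g t| ≤ 1) :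
    ((Measure.pi fun _ : Fin (n + 1) => μ).withDensity
      fun x => ENNReal.ofReal (1 + ∏ j, g (x j))).map i.removeNth =
      Measure.pi fun _ : Fin n => μ := by
  have hrem : Measurable (i.removeNth : (Fin (n + 1) → ℝ) → Fin n → ℝ) :=
    measurable_pi_lambda _ fun j => measurable_pi_apply _
  have hint : Integrable g μ :=
    Integrable.of_bound hg.aestronglyMeasurable 1 (.of_forall hbound)
  have hzero : ∫ t, g t ∂μ = 0 := by
    have h : ∫ t, g t ∂μ = ∫ t, g (-t) ∂μ := by
      conv_lhs => rw [← hμ]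
      exact integral_map measurable_neg.aemeasurable hg.aestronglyMeasurable
    simp_rw [hodd, integral_neg] at h
    linarith
  have hfiber (c : ℝ) (hc : |c| ≤ 1) : ∫⁻ t, ENNReal.ofReal (1 + g t * c) ∂μ = 1 := by
    have hint' : Integrable (fun t => 1 + g t * c) μ :=
      (integrable_const 1).add (hint.mul_const c)
    rw [← ofReal_integral_eq_lintegral_ofReal hint',
      integral_add (integrable_const 1) (hint.mul_const c), integral_mul_const, hzero]
    · simp
    · refine .of_forall fun t => ?_
      have h : |g t * c| ≤ 1 := by
        rw [abs_mul]
        exact mul_le_one₀ (hbound t) (abs_nonneg c) hc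
      simpa using by linarith [neg_le_of_abs_le h]
  have hprod (y : Fin n → ℝ) : |∏ j, g (y j)| ≤ 1 := by
    rw [Finset.abs_prod]
    exact Finset.prod_le_one (fun j _ => abs_nonneg _) fun j _ => hbound _
  ext s hs
  have hmeas : Measurable fun p : ℝ × (Fin n → ℝ) =>
      s.indicator (fun y => ENNReal.ofReal (1 + g p.1 * ∏ j, g (y j))) p.2 := by
    have h : Measurable fun p : ℝ × (Fin n → ℝ) =>
        ENNReal.ofReal (1 + g p.1 * ∏ j, g (p.2 j)) := by fun_prop
    exact h.indicator (measurable_snd hs)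
  rw [Measure.map_apply hrem hs, withDensity_apply _ (hrem hs),
    ← lintegral_indicator (hrem hs)]
  calc
    _ = ∫⁻ x, (fun p : ℝ × (Fin n → ℝ) =>
          s.indicator (fun y => ENNReal.ofReal (1 + g p.1 * ∏ j, g (y j))) p.2)
          (MeasurableEquiv.piFinSuccAbove (fun _ => ℝ) i x)
          ∂(Measure.pi fun _ : Fin (n + 1) => μ) := by
        refine lintegral_congr fun x => ?_
        simp only [Set.indicator, i.prod_univ_succAbove]
        rfl
    _ = ∫⁻ y, ∫⁻ t, s.indicator (fun y => ENNReal.ofReal (1 + g t * ∏ j, g (y j))) y ∂μ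
          ∂(Measure.pi fun _ : Fin n => μ) := by
        rw [(measurePreserving_piFinSuccAbove (fun _ : Fin (n + 1) => μ) i).lintegral_comp hmeas,
          lintegral_prod_symm' _ hmeas]
    _ = ∫⁻ y, s.indicator 1 y ∂(Measure.pi fun _ : Fin n => μ) := by
        refine lintegral_congr fun y => ?_
        by_cases hy : y ∈ s
        · simp [hy, hfiber _ (hprod y)]
        · simp [hy]
    _ = _ := lintegral_indicator_one hs

theorem abs_mul_exp_neg_sq_div_two_le_one (t : ℝ) : |t * Real.exp (-t ^ 2 / 2)| ≤ 1 := by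
  rw [abs_mul, abs_of_pos (Real.exp_pos _), neg_div, Real.exp_neg, ← div_eq_mul_inv,
    div_le_one (Real.exp_pos _), ← sq_abs]
  nlinarith [Real.add_one_le_exp (|t| ^ 2 / 2), sq_nonneg (|t| - 1)]

theorem psi_eq_mul_prod_gaussianPDFReal (k : ℕ) (x : Fin k → ℝ) :
    psi k x = (∏ i, gaussianPDFReal 0 1 (x i)) *
      (1 + ∏ i, x i * Real.exp (-(x i) ^ 2 / 2)) := by
  have hexp : ∏ i, Real.exp (-(x i) ^ 2 / 2) = Real.exp (-(∑ i, x i ^ 2) / 2) := by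
    rw [← Real.exp_sum, ← Finset.sum_div, Finset.sum_neg_distrib]
  have hconst : (2 * Real.pi) ^ (-(k : ℝ) / 2) = (√(2 * Real.pi))⁻¹ ^ k := by
    rw [Real.sqrt_eq_rpow, ← Real.rpow_neg (by positivity), ← Real.rpow_mul_natCast (by positivity)]
    ring_nf
  simp only [psi, gaussianPDFReal, Finset.prod_mul_distrib, hexp, hconst, NNReal.coe_one, mul_one,
    sub_zero, Finset.prod_const, Finset.card_univ, Fintype.card_fin]
  ring

theorem nu_eq_withDensity_pi_gaussianReal (k : ℕ) :
    nu k = (Measure.pi fun _ : Fin k => gaussianReal 0 1).withDensity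
      fun x => ENNReal.ofReal (1 + ∏ i, x i * Real.exp (-(x i) ^ 2 / 2)) := by
  have hsigma : SigmaFinite ((volume : Measure ℝ).withDensity (gaussianPDF 0 1)) := by
    rw [← gaussianReal_of_var_ne_zero 0 one_ne_zero]
    infer_instance
  have hpdf : Measurable fun x : Fin k → ℝ => ∏ i, gaussianPDF 0 1 (x i) :=
    Finset.measurable_prod _ fun i _ =>
      (measurable_gaussianPDF 0 1).comp (measurable_pi_apply i)
  rw [gaussianReal_of_var_ne_zero 0 one_ne_zero,
    pi_withDensity (fun _ : Fin k => (volume : Measure ℝ)) fun _ => measurable_gaussianPDF 0 1,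
    ← withDensity_mul _ hpdf (by fun_prop), nu, volume_pi]
  congr 1 with x
  rw [psi_eq_mul_prod_gaussianPDFReal, ENNReal.ofReal_mul
    (Finset.prod_nonneg fun i _ => gaussianPDFReal_nonneg 0 1 _),
    ENNReal.ofReal_prod_of_nonneg fun i _ => gaussianPDFReal_nonneg 0 1 _]
  rfl

theorem deleteCoord_succ (n : ℕ) (i : Fin (n + 1)) :
    deleteCoord (n + 1) i = (i.removeNth : (Fin (n + 1) → ℝ) → Fin n → ℝ) := by
  ext x j
  simp only [deleteCoord, Fin.removeNth, Fin.succAbove, Fin.lt_def, Fin.val_castSucc]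
  split_ifs <;> rfl

/-- The pushforward of `ν` under any coordinate-deletion map is the `(k-1)`-fold
product of standard Gaussians: the remaining coordinates are i.i.d. `N(0,1)`. -/
theorem map_nu_deleteCoord (k : ℕ) (hk : 1 < k) (i : Fin k) :
    (nu k).map (deleteCoord k i) =
      Measure.pi (fun _ : Fin (k - 1) => gaussianReal 0 1) := by
  obtain ⟨n, rfl⟩ : ∃ n, k = n + 1 := ⟨k - 1, by omega⟩
  rw [nu_eq_withDensity_pi_gaussianReal, deleteCoord_succ]
  exact map_removeNth_withDensity_one_add_prod i (gaussianReal 0 1)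
    (by simp [gaussianReal_map_neg]) (g := fun t => t * Real.exp (-t ^ 2 / 2)) (by fun_prop)
    (fun t => by simp) abs_mul_exp_neg_sq_div_two_le_one
end

section
/- For any integers n₁ < n₂ < ⋯ < n_{k-1}, the joint distribution under μ of the random vector (Y_{n₁}, Y_{n₂}, …, Y_{n_{k-1}}) in ℝ^{k-1} equals the (k-1)-fold product of the Gaussian measure N(0,k); i.e., any k-1 of the random variables Y_n are i.i.d. N(0,k), so every (k-1)-dimensional marginal of the process is Gaussian with mean 0 and covariance matrix k·I. -/
open Real MeasureTheory ProbabilityTheory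

/-- `μ` is the joint law of an i.i.d. bilateral sequence `(X_{n,1},…,X_{n,k})`,
`n ∈ ℤ`, with common distribution `ν`: every finite-dimensional marginal of `μ`
is the corresponding finite product of copies of `ν`. -/
def IsIIDSeq (k : ℕ) (μ : Measure (ℤ → Fin k → ℝ)) : Prop :=
  ∀ I : Finset ℤ, μ.map I.restrict = Measure.pi fun _ : I => nu k

/-- `Y n = X_{n,k} + X_{n+1,k-1} + ⋯ + X_{n+k-1,1}` (coordinates indexed by
`Fin k`, so coordinate `i ∈ {1,…,k}` corresponds to index `i-1 : Fin k`). -/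
noncomputable def Y (k : ℕ) (n : ℤ) (ω : ℤ → Fin k → ℝ) : ℝ :=
  ∑ j : Fin k, ω (n + ((j : ℕ) : ℤ)) j.rev

lemma psi_nonneg (k : ℕ) (x : Fin k → ℝ) : 0 ≤ psi k x := by
  have hfactor : ∀ y : ℝ, |y * Real.exp (-(y ^ 2) / 2)| ≤ 1 := fun y => by
    rw [abs_mul, Real.abs_exp, neg_div, Real.exp_neg, ← div_eq_mul_inv,
      div_le_one (Real.exp_pos _)]
    have h := Real.add_one_le_exp (y ^ 2 / 2)
    nlinarith [sq_nonneg (|y| - 1), sq_abs y]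
  have hprod : |(∏ i, x i) * Real.exp (-(∑ i, x i ^ 2) / 2)| ≤ 1 := by
    rw [← Finset.sum_neg_distrib, Finset.sum_div, Real.exp_sum, ← Finset.prod_mul_distrib,
      Finset.abs_prod]
    exact Finset.prod_le_one (fun _ _ => abs_nonneg _) fun i _ => hfactor (x i)
  have h := neg_abs_le ((∏ i, x i) * Real.exp (-(∑ i, x i ^ 2) / 2))
  have h' : 0 ≤ 1 + (∏ i, x i) * Real.exp (-(∑ i, x i ^ 2) / 2) := by linarith
  unfold psi
  positivity

lemma psi_eq_prod_add_prod (k : ℕ) (x : Fin k → ℝ) :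
    psi k x = ∏ i, gaussianPDFReal 0 1 (x i) +
      ∏ i, gaussianPDFReal 0 1 (x i) * (x i * Real.exp (-(x i ^ 2) / 2)) := by
  have hconst : (2 * Real.pi) ^ (-(k : ℝ) / 2) = ((√(2 * Real.pi))⁻¹) ^ k := by
    rw [Real.sqrt_eq_rpow, ← Real.rpow_neg (by positivity), ← Real.rpow_natCast,
      ← Real.rpow_mul (by positivity)]
    congr 1
    ring
  have hpdf : ∏ i, gaussianPDFReal 0 1 (x i) =
      (2 * Real.pi) ^ (-(k : ℝ) / 2) * Real.exp (-(∑ i, x i ^ 2) / 2) := by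
    rw [hconst, ← Finset.sum_neg_distrib, Finset.sum_div, Real.exp_sum]
    simp [gaussianPDFReal, Finset.prod_mul_distrib]
  rw [Finset.prod_mul_distrib, hpdf, Finset.prod_mul_distrib, ← Real.exp_sum,
    ← Finset.sum_div, Finset.sum_neg_distrib, psi]
  ring

lemma integral_cexp_gaussianPDFReal (s : ℝ) :
    ∫ x : ℝ, (gaussianPDFReal 0 1 x : ℂ) * Complex.exp (s * x * Complex.I) =
      Complex.exp (-(s : ℂ) ^ 2 / 2) := by
  have h := charFun_gaussianReal (μ := 0) (v := 1) s
  rw [charFun_apply_real, integral_gaussianReal_eq_integral_smul one_ne_zero] at h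
  simp only [Complex.real_smul] at h
  rw [h]
  simp [neg_div]

lemma integrable_mul_cexp {f : ℝ → ℝ} (hf : Integrable f) (s : ℝ) :
    Integrable fun x : ℝ => (f x : ℂ) * Complex.exp (s * x * Complex.I) := by
  refine hf.ofReal.mul_bdd (c := 1) (by fun_prop) (ae_of_all _ fun x => ?_)
  rw [← Complex.ofReal_mul, Complex.norm_exp_ofReal_mul_I]

lemma integrable_gaussianPDFReal_mul :
    Integrable fun x : ℝ => gaussianPDFReal 0 1 x * (x * Real.exp (-(x ^ 2) / 2)) := by
  refine ((integrable_mul_exp_neg_mul_sq one_pos).const_mul (√(2 * Real.pi))⁻¹).congr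
    (ae_of_all _ fun x => ?_)
  have h : Real.exp (-1 * x ^ 2) = Real.exp (-(x ^ 2) / 2) * Real.exp (-(x ^ 2) / 2) := by
    rw [← Real.exp_add]
    ring_nf
  simp only [gaussianPDFReal, h, sub_zero, NNReal.coe_one, mul_one]
  ring

lemma integral_gaussianPDFReal_mul :
    ∫ x : ℝ, ((gaussianPDFReal 0 1 x * (x * Real.exp (-(x ^ 2) / 2)) : ℝ) : ℂ) = 0 := by
  rw [integral_complex_ofReal, Complex.ofReal_eq_zero]
  have h := integral_neg_eq_self
    (fun x : ℝ => gaussianPDFReal 0 1 x * (x * Real.exp (-(x ^ 2) / 2))) volume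
  simp only [gaussianPDFReal, sub_zero, neg_sq, neg_mul, mul_neg, integral_neg] at h ⊢
  linarith

/-- The characteristic function of `ν` agrees with that of the standard Gaussian measure
on the coordinate hyperplanes. -/
lemma integral_cexp_nu {k : ℕ} (s : Fin k → ℝ) {i₀ : Fin k} (hs : s i₀ = 0) :
    ∫ x, Complex.exp ((∑ i, s i * x i : ℝ) * Complex.I) ∂(nu k) =
      ∏ i, Complex.exp (-(s i : ℂ) ^ 2 / 2) := by
  have hmeas : Measurable fun x : Fin k → ℝ => ENNReal.ofReal (psi k x) := by
    unfold psi
    fun_prop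
  have hexp : ∀ x : Fin k → ℝ, Complex.exp ((∑ i, s i * x i : ℝ) * Complex.I) =
      ∏ i, Complex.exp (s i * x i * Complex.I) := fun x => by
    rw [← Complex.exp_sum, ← Finset.sum_mul]
    push_cast
    rfl
  rw [nu, integral_withDensity_eq_integral_toReal_smul hmeas
    (ae_of_all _ fun _ => ENNReal.ofReal_lt_top)]
  simp only [ENNReal.toReal_ofReal (psi_nonneg k _)]
  simp only [psi_eq_prod_add_prod, hexp, Complex.real_smul, Complex.ofReal_add,
    Complex.ofReal_prod, add_mul, ← Finset.prod_mul_distrib]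
  have hg := fun i => integrable_mul_cexp (integrable_gaussianPDFReal 0 1) (s i)
  have hh := fun i => integrable_mul_cexp integrable_gaussianPDFReal_mul (s i)
  rw [volume_pi, integral_add (Integrable.fintype_prod hg) (Integrable.fintype_prod hh),
    integral_fintype_prod_eq_prod
      (fun i (x : ℝ) => (gaussianPDFReal 0 1 x : ℂ) * Complex.exp (s i * x * Complex.I)),
    integral_fintype_prod_eq_prod
      (fun i (x : ℝ) => ((gaussianPDFReal 0 1 x * (x * Real.exp (-(x ^ 2) / 2)) : ℝ) : ℂ) *
        Complex.exp (s i * x * Complex.I))]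
  refine (congrArg₂ (· + ·) ?_ (Finset.prod_eq_zero (Finset.mem_univ i₀) ?_)).trans (add_zero _)
  · simp only [integral_cexp_gaussianPDFReal]
  · simpa [hs] using integral_gaussianPDFReal_mul

/-- The coefficient of the coordinate `ω m i` in `∑ a, t a * Y k (n a) ω`. -/
noncomputable def coeffY {k : ℕ} (n : Fin (k - 1) → ℤ) (t : Fin (k - 1) → ℝ) (m : ℤ)
    (i : Fin k) : ℝ :=
  ∑ a, if n a + (i.rev : ℕ) = m then t a else 0

/-- The indices of the coordinates on which the variables `Y k (n a)` depend. -/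
def supportY {k : ℕ} (n : Fin (k - 1) → ℤ) : Finset ℤ :=
  Finset.univ.image fun p : Fin (k - 1) × Fin k => n p.1 + (p.2.rev : ℕ)

lemma mem_supportY {k : ℕ} (n : Fin (k - 1) → ℤ) (a : Fin (k - 1)) (i : Fin k) :
    n a + (i.rev : ℕ) ∈ supportY n :=
  Finset.mem_image.2 ⟨(a, i), Finset.mem_univ _, rfl⟩

lemma sum_Y_mul {k : ℕ} (n : Fin (k - 1) → ℤ) (t : Fin (k - 1) → ℝ) (ω : ℤ → Fin k → ℝ) :
    ∑ a, Y k (n a) ω * t a = ∑ m : supportY n, ∑ i, coeffY n t m i * ω m i := by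
  have hY : ∀ a, Y k (n a) ω = ∑ i : Fin k, ω (n a + (i.rev : ℕ)) i := fun a => by
    rw [Y, ← Equiv.sum_comp Fin.revPerm]
    simp
  rw [Finset.sum_coe_sort (supportY n) fun m => ∑ i, coeffY n t m i * ω m i]
  simp only [hY, coeffY, Finset.sum_mul]
  rw [Finset.sum_comm, Finset.sum_comm (s := supportY n)]
  refine Finset.sum_congr rfl fun i _ => ?_
  rw [Finset.sum_comm (s := supportY n)]
  refine Finset.sum_congr rfl fun a _ => ?_
  simp [mem_supportY, mul_comm, -Fin.val_rev]

lemma exists_coeffY_eq_zero {k : ℕ} (hk : 0 < k) (n : Fin (k - 1) → ℤ) (t : Fin (k - 1) → ℝ)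
    (m : ℤ) : ∃ i, coeffY n t m i = 0 := by
  by_contra! h
  have h' : ∀ i : Fin k, ∃ a, n a + (i.rev : ℕ) = m := fun i => by
    by_contra! hi
    exact h i (Finset.sum_eq_zero fun a _ => if_neg (hi a))
  choose f hf using h'
  have hinj : Function.Injective f := fun i j hij => by
    have hi := hf i
    have hj := hf j
    rw [hij] at hi
    exact Fin.rev_injective (Fin.ext (by omega))
  have := Fintype.card_le_of_injective f hinj
  simp only [Fintype.card_fin] at this
  omega

lemma coeffY_sq {k : ℕ} {n : Fin (k - 1) → ℤ} (hn : Function.Injective n)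
    (t : Fin (k - 1) → ℝ) (m : ℤ) (i : Fin k) :
    coeffY n t m i ^ 2 = ∑ a, if n a + (i.rev : ℕ) = m then t a ^ 2 else 0 := by
  unfold coeffY
  by_cases h : ∃ a, n a + (i.rev : ℕ) = m
  · obtain ⟨a, rfl⟩ := h
    simp [hn.eq_iff]
  · push Not at h
    simp [h, -Fin.val_rev]

lemma sum_coeffY_sq {k : ℕ} {n : Fin (k - 1) → ℤ} (hn : Function.Injective n)
    (t : Fin (k - 1) → ℝ) :
    ∑ m : supportY n, ∑ i, coeffY n t m i ^ 2 = k * ∑ a, t a ^ 2 := by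
  rw [Finset.sum_coe_sort (supportY n) fun m => ∑ i, coeffY n t m i ^ 2]
  simp only [coeffY_sq hn]
  rw [Finset.sum_comm, Finset.sum_congr rfl fun i _ => Finset.sum_comm]
  simp [mem_supportY, -Fin.val_rev]

/-- Any `k-1` of the random variables `Y_n` are i.i.d. `N(0,k)`: every
`(k-1)`-dimensional marginal of the process is Gaussian with mean `0` and
covariance matrix `k·I`. -/
theorem map_Y_kSubOne_marginal (k : ℕ) (hk : 1 < k)
    (μ : Measure (ℤ → Fin k → ℝ)) [IsProbabilityMeasure μ]
    (hμ : IsIIDSeq k μ) (n : Fin (k - 1) → ℤ) (hn : StrictMono n) :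
    μ.map (fun ω (i : Fin (k - 1)) => Y k (n i) ω) =
      Measure.pi (fun _ : Fin (k - 1) => gaussianReal 0 (k : NNReal)) := by
  have hYm : Measurable fun ω (i : Fin (k - 1)) => Y k (n i) ω := by
    unfold Y
    fun_prop
  have : IsProbabilityMeasure (μ.map fun ω (i : Fin (k - 1)) => Y k (n i) ω) :=
    Measure.isProbabilityMeasure_map hYm.aemeasurable
  have : SigmaFinite (nu k) := by
    unfold nu
    infer_instance
  refine charFun_eq_pi_iff.1 fun t => ?_
  have hinner : ∀ ω, inner ℝ (WithLp.toLp 2 fun i => Y k (n i) ω) t =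
      ∑ m : supportY n, ∑ i, coeffY n t m i * ω m i := fun ω => by
    rw [← sum_Y_mul]
    simp [PiLp.inner_apply, mul_comm]
  let F : (supportY n → Fin k → ℝ) → ℂ := fun x =>
    ∏ m : supportY n, Complex.exp ((∑ i, coeffY n t m i * x m i : ℝ) * Complex.I)
  have hF : Continuous F := by
    fun_prop
  calc charFun ((μ.map fun ω i => Y k (n i) ω).map (WithLp.toLp 2)) t
      = ∫ ω, F ((supportY n).restrict ω) ∂μ := by
        rw [Measure.map_map (WithLp.measurable_toLp 2 _) hYm, charFun_apply,
          integral_map ((WithLp.measurable_toLp 2 _).comp hYm).aemeasurable (by fun_prop)]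
        refine integral_congr_ae (ae_of_all _ fun ω => ?_)
        simp only [Function.comp_apply, hinner, F, Finset.restrict]
        rw [← Complex.exp_sum, ← Finset.sum_mul, Complex.ofReal_sum]
    _ = ∫ x, F x ∂(Measure.pi fun _ : supportY n => nu k) := by
        rw [← hμ, integral_map (by fun_prop) hF.aestronglyMeasurable]
    _ = ∏ m : supportY n, ∏ i, Complex.exp (-(coeffY n t m i : ℂ) ^ 2 / 2) := by
        rw [integral_fintype_prod_eq_prod fun (m : supportY n) (x : Fin k → ℝ) =>
          Complex.exp ((∑ i, coeffY n t m i * x i : ℝ) * Complex.I)]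
        refine Finset.prod_congr rfl fun m _ => ?_
        obtain ⟨i, hi⟩ := exists_coeffY_eq_zero (by omega) n t m
        exact integral_cexp_nu _ hi
    _ = ∏ a, charFun (gaussianReal 0 k) (t a) := by
        have h := congrArg (Complex.ofReal) (sum_coeffY_sq hn.injective t)
        push_cast at h
        simp only [charFun_gaussianReal, ← Complex.exp_sum, ← Finset.sum_div,
          Finset.sum_neg_distrib, h]
        simp [Finset.mul_sum, neg_div, Finset.sum_div]
end
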